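/- arXiv:1510.03459 — 2 statements merged into one kernel-verified Lean document; each statement's English description precedes it below -/
import Mathlib

section
/- Let 0 < q < 1 and define f(x) = e^{(1−q^x)/(1−q)} · Γ_q(x) for x ≥ 1. Then f is geometrically convex on [1, ∞), i.e., f(√(x y)) ≤ √(f(x)f(y)) for all x, y ≥ 1. -/
/-- The `q`-extension of the Gamma function: for fixed `q ∈ (0,1)` and `x > 0`,
`Γ_q(x) = (1-q)^{1-x} ∏_{n=0}^∞ (1-q^{n+1})/(1-q^{n+x})`. -/
noncomputable def qGamma (q x : ℝ) : ℝ :=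
  (1 - q) ^ (1 - x) * ∏' n : ℕ, (1 - q ^ (n + 1)) / (1 - q ^ ((n : ℝ) + x))

/-- The `q`-extension of the digamma function:
`ψ_q(x) = -ln(1-q) + (ln q) ∑_{n=1}^∞ q^{n x}/(1-q^n)`. -/
noncomputable def qDigamma (q x : ℝ) : ℝ :=
  -Real.log (1 - q) + Real.log q * ∑' n : ℕ, q ^ (((n : ℝ) + 1) * x) / (1 - q ^ (n + 1))

open Real in
/-- The second derivative of `s ↦ a * exp s + a ^ exp s / (1 - a)` is nonnegative for `s ≥ 0`;
here `a = exp (-L)`. -/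
lemma mul_exp_neg_mul_one_sub_le {L x : ℝ} (hL : 0 < L) (hx : 1 ≤ x) :
    L * exp (-(L * x)) * (1 - L * x) ≤ exp (-L) * (1 - exp (-L)) := by
  have hlt : exp (-L) < 1 := by simpa using hL
  have hpos := exp_pos (-L)
  rcases le_or_gt 1 (L * x) with h | h
  · have h₁ : L * exp (-(L * x)) * (1 - L * x) ≤ 0 :=
      mul_nonpos_of_nonneg_of_nonpos (by positivity) (by linarith)
    have h₂ : 0 < exp (-L) * (1 - exp (-L)) := mul_pos hpos (by linarith)
    linarith
  · have hLx : L ≤ L * x := by nlinarith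
    have h₁ : exp (-(L * x)) * (1 - L * x) ≤ exp (-L) * (1 - L) :=
      mul_le_mul (exp_le_exp.2 (by linarith)) (by linarith) (by linarith) hpos.le
    have h₂ : L * (1 - L) ≤ 1 - exp (-L) := by
      have h₃ : exp (-L) * (1 + L) ≤ 1 := by
        calc exp (-L) * (1 + L) ≤ exp (-L) * exp L := by
              gcongr; linarith [add_one_le_exp L]
          _ = 1 := by rw [← exp_add]; simp
      nlinarith [pow_pos hL 3]
    calc L * exp (-(L * x)) * (1 - L * x) = L * (exp (-(L * x)) * (1 - L * x)) := by ring
      _ ≤ L * (exp (-L) * (1 - L)) := by gcongr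
      _ = exp (-L) * (L * (1 - L)) := by ring
      _ ≤ _ := by gcongr

open Real in
lemma convexOn_mul_exp_add_exp_neg_mul_exp {L : ℝ} (hL : 0 < L) :
    ConvexOn ℝ (Set.Ici 0)
      (fun s => exp (-L) * exp s + exp (-(L * exp s)) / (1 - exp (-L))) := by
  have hlt : 0 < 1 - exp (-L) := by
    have : exp (-L) < 1 := by simpa using hL
    linarith
  have hinner : ∀ s, HasDerivAt (fun s => exp (-(L * exp s)))
      (exp (-(L * exp s)) * (-(L * exp s))) s :=
    fun s => (((hasDerivAt_exp s).const_mul L).neg).exp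
  have h₁ : ∀ s, HasDerivAt
      (fun s => exp (-L) * exp s + exp (-(L * exp s)) / (1 - exp (-L)))
      (exp (-L) * exp s + exp (-(L * exp s)) * (-(L * exp s)) / (1 - exp (-L))) s :=
    fun s => ((hasDerivAt_exp s).const_mul _).add ((hinner s).div_const _)
  have h₂ : ∀ s, HasDerivAt
      (fun s => exp (-L) * exp s + exp (-(L * exp s)) * (-(L * exp s)) / (1 - exp (-L)))
      (exp (-L) * exp s + (exp (-(L * exp s)) * (-(L * exp s)) * (-(L * exp s)) +
        exp (-(L * exp s)) * (-(L * exp s))) / (1 - exp (-L))) s :=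
    fun s => ((hasDerivAt_exp s).const_mul _).add
      (((hinner s).mul ((hasDerivAt_exp s).const_mul L).neg).div_const _)
  refine convexOn_of_hasDerivWithinAt2_nonneg (convex_Ici 0)
    (fun s _ => (h₁ s).continuousAt.continuousWithinAt)
    (fun s _ => (h₁ s).hasDerivWithinAt) (fun s _ => (h₂ s).hasDerivWithinAt) ?_
  intro s hs
  rw [interior_Ici] at hs
  have key := mul_exp_neg_mul_one_sub_le hL (one_le_exp (le_of_lt hs))
  have : exp (-L) * exp s + (exp (-(L * exp s)) * (-(L * exp s)) * (-(L * exp s)) +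
        exp (-(L * exp s)) * (-(L * exp s))) / (1 - exp (-L)) =
      exp s * (exp (-L) * (1 - exp (-L)) - L * exp (-(L * exp s)) * (1 - L * exp s)) /
        (1 - exp (-L)) := by
    field_simp
    ring
  rw [this]
  exact div_nonneg (mul_nonneg (exp_pos s).le (by linarith)) hlt.le

/-- The function `x ↦ a * x + a ^ x / (1 - a)` is convex in `log x` on `[1, ∞)`. -/
lemma mul_sqrt_add_rpow_sqrt_div_le {a x y : ℝ} (ha0 : 0 < a) (ha1 : a < 1)
    (hx : 1 ≤ x) (hy : 1 ≤ y) :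
    a * √(x * y) + a ^ √(x * y) / (1 - a) ≤
      ((a * x + a ^ x / (1 - a)) + (a * y + a ^ y / (1 - a))) / 2 := by
  have hL : 0 < -Real.log a := neg_pos.2 (Real.log_neg ha0 ha1)
  have hx0 : 0 < x := by linarith
  have hy0 : 0 < y := by linarith
  have h := (convexOn_mul_exp_add_exp_neg_mul_exp hL).2 (Set.mem_Ici.2 (Real.log_nonneg hx))
    (Set.mem_Ici.2 (Real.log_nonneg hy)) (by norm_num : (0 : ℝ) ≤ 1 / 2)
    (by norm_num : (0 : ℝ) ≤ 1 / 2) (by norm_num)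
  have hm : Real.exp ((1 / 2) * Real.log x + (1 / 2) * Real.log y) = √(x * y) := by
    rw [← mul_add, ← Real.log_mul hx0.ne' hy0.ne', one_div_mul_eq_div,
      ← Real.log_sqrt (mul_pos hx0 hy0).le, Real.exp_log (Real.sqrt_pos.2 (mul_pos hx0 hy0))]
  simp only [smul_eq_mul, hm, neg_neg, neg_mul, Real.exp_log ha0, Real.exp_log hx0,
    Real.exp_log hy0, ← Real.rpow_def_of_pos ha0] at h
  linarith

/-- Expanding the logarithm and summing the geometric series in `n` first. -/
lemma hasSum_neg_log_one_sub_rpow {q x : ℝ} (hq0 : 0 < q) (hq1 : q < 1) (hx : 1 ≤ x) :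
    Summable (fun k : ℕ => (q ^ (k + 1)) ^ x / ((k + 1) * (1 - q ^ (k + 1)))) ∧
    HasSum (fun n : ℕ => -Real.log (1 - q ^ ((n : ℝ) + x)))
      (∑' k : ℕ, (q ^ (k + 1)) ^ x / ((k + 1) * (1 - q ^ (k + 1)))) := by
  have hpow : ∀ k : ℕ, q ^ (k + 1) ≤ q := fun k =>
    pow_le_of_le_one hq0.le hq1.le k.succ_ne_zero
  have hsum : Summable (fun k : ℕ => (q ^ (k + 1)) ^ x / ((k + 1) * (1 - q ^ (k + 1)))) := by
    refine Summable.of_nonneg_of_le (fun k => ?_) (fun k => ?_)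
      ((summable_geometric_of_lt_one hq0.le hq1).mul_left (1 - q)⁻¹)
    · have := hpow k
      exact div_nonneg (by positivity) (mul_nonneg (by positivity) (by linarith))
    · have h₁ := hpow k
      have h₂ : (q ^ (k + 1)) ^ x ≤ q ^ k := by
        calc (q ^ (k + 1)) ^ x ≤ (q ^ (k + 1)) ^ (1 : ℝ) :=
              Real.rpow_le_rpow_of_exponent_ge (by positivity) (by linarith) hx
          _ = q ^ (k + 1) := Real.rpow_one _
          _ ≤ q ^ k := pow_le_pow_of_le_one hq0.le hq1.le k.le_succ
      rw [inv_mul_eq_div]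
      have h₃ : 1 - q ≤ (k + 1) * (1 - q ^ (k + 1)) := by
        have : (0 : ℝ) ≤ k := k.cast_nonneg
        nlinarith
      exact div_le_div₀ (by positivity) h₂ (by linarith) h₃
  refine ⟨hsum, ?_⟩
  obtain ⟨F, hF⟩ : ∃ F : ℕ × ℕ → ℝ, ∀ k n,
      F (k, n) = (q ^ ((n : ℝ) + x)) ^ (k + 1) / ((k : ℝ) + 1) :=
    ⟨fun p => (q ^ ((p.2 : ℝ) + x)) ^ (p.1 + 1) / ((p.1 : ℝ) + 1), fun _ _ => rfl⟩
  have hF0 : 0 ≤ F := fun ⟨k, n⟩ => by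
    rw [hF]
    exact div_nonneg (by positivity) (by positivity)
  have hrow : ∀ k : ℕ, HasSum (fun n => F (k, n))
      ((q ^ (k + 1)) ^ x / ((k + 1) * (1 - q ^ (k + 1)))) := fun k => by
    have h := (hasSum_geometric_of_lt_one (by positivity : 0 ≤ q ^ (k + 1))
      (by linarith [hpow k])).mul_left ((q ^ (k + 1)) ^ x / ((k : ℝ) + 1))
    rw [← div_eq_mul_inv, ← div_mul_eq_div_div] at h
    refine h.congr_fun fun n => ?_
    rw [hF, Real.rpow_add hq0, Real.rpow_natCast, mul_pow, Real.rpow_pow_comm hq0.le]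
    ring
  have hFsum : Summable F := by
    rw [summable_prod_of_nonneg hF0]
    exact ⟨fun k => (hrow k).summable, by simpa only [(hrow _).tsum_eq] using hsum⟩
  have hcol : ∀ n : ℕ, HasSum (fun k => F (k, n)) (-Real.log (1 - q ^ ((n : ℝ) + x))) :=
    fun n => by
      simp only [hF]
      refine Real.hasSum_pow_div_log_of_abs_lt_one ?_
      rw [abs_of_pos (by positivity)]
      exact Real.rpow_lt_one hq0.le hq1 (by positivity)
  have htotal : HasSum F (∑' k : ℕ, (q ^ (k + 1)) ^ x / ((k + 1) * (1 - q ^ (k + 1)))) := by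
    have h := hFsum.hasSum
    rwa [← (h.prod_fiberwise hrow).tsum_eq] at h
  exact ((Equiv.prodComm ℕ ℕ).hasSum_iff.2 htotal).prod_fiberwise hcol

lemma qGamma_eq_exp {q x : ℝ} (hq0 : 0 < q) (hq1 : q < 1) (hx : 1 ≤ x) :
    qGamma q x = Real.exp (Real.log (1 - q) * (1 - x) +
      (∑' k : ℕ, (q ^ (k + 1)) ^ x / ((k + 1) * (1 - q ^ (k + 1))) -
        ∑' k : ℕ, (q ^ (k + 1)) ^ (1 : ℝ) / ((k + 1) * (1 - q ^ (k + 1))))) := by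
  have hone : ∀ n : ℕ, q ^ ((n : ℝ) + 1) = q ^ (n + 1) := fun n => by
    rw [← Nat.cast_add_one, Real.rpow_natCast]
  have hpos : ∀ {z : ℝ}, 1 ≤ z → ∀ n : ℕ, 0 < 1 - q ^ ((n : ℝ) + z) := fun hz n =>
    sub_pos.2 (Real.rpow_lt_one hq0.le hq1 (by positivity))
  have hlog : HasSum (fun n : ℕ => Real.log ((1 - q ^ (n + 1)) / (1 - q ^ ((n : ℝ) + x))))
      (∑' k : ℕ, (q ^ (k + 1)) ^ x / ((k + 1) * (1 - q ^ (k + 1))) -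
        ∑' k : ℕ, (q ^ (k + 1)) ^ (1 : ℝ) / ((k + 1) * (1 - q ^ (k + 1)))) := by
    refine ((hasSum_neg_log_one_sub_rpow hq0 hq1 hx).2.sub
      (hasSum_neg_log_one_sub_rpow hq0 hq1 le_rfl).2).congr_fun fun n => ?_
    rw [← hone, Real.log_div (hpos le_rfl n).ne' (hpos hx n).ne']
    ring
  rw [qGamma, Real.exp_add, ← Real.rpow_def_of_pos (by linarith), ← hlog.tsum_eq,
    Real.rexp_tsum_eq_tprod (fun n => ?_) hlog.summable]
  rw [← hone]
  exact div_pos (hpos le_rfl n) (hpos hx n)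

/-- After cancellation of the terms in `q ^ x`, the logarithm of `exp [x]_q * Γ_q(x)` is, up to a
constant, a series of functions convex in `log x`. -/
lemma exp_mul_qGamma_eq_exp_tsum {q : ℝ} (hq0 : 0 < q) (hq1 : q < 1) :
    ∃ C : ℝ, ∀ x : ℝ, 1 ≤ x → ∃ S : ℝ,
      HasSum (fun k : ℕ => (q ^ (k + 2) * x + (q ^ (k + 2)) ^ x / (1 - q ^ (k + 2))) / (k + 2)) S ∧
      Real.exp ((1 - q ^ x) / (1 - q)) * qGamma q x = Real.exp (C + q * x + S) := by
  refine ⟨1 / (1 - q) + Real.log (1 - q) -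
    ∑' k : ℕ, (q ^ (k + 1)) ^ (1 : ℝ) / ((k + 1) * (1 - q ^ (k + 1))), fun x hx => ?_⟩
  have h₁ := (hasSum_neg_log_one_sub_rpow hq0 hq1 hx).1.hasSum
  have h₂ := (Real.hasSum_pow_div_log_of_abs_lt_one (x := q)
    (by rwa [abs_of_pos hq0])).mul_right x
  have h := (hasSum_nat_add_iff' 1).2 (h₂.add h₁)
  refine ⟨_, h.congr_fun fun k => ?_, ?_⟩
  · push_cast
    rw [div_mul_eq_div_div_swap, add_div, add_assoc (k : ℝ), one_add_one_eq_two]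
    ring
  · rw [qGamma_eq_exp hq0 hq1 hx, ← Real.exp_add]
    congr 1
    simp
    ring

theorem geomConvex_exp_mul_qGamma (q : ℝ) (hq0 : 0 < q) (hq1 : q < 1) :
    ∀ x y : ℝ, 1 ≤ x → 1 ≤ y →
      Real.exp ((1 - q ^ Real.sqrt (x * y)) / (1 - q)) * qGamma q (Real.sqrt (x * y)) ≤
        Real.sqrt ((Real.exp ((1 - q ^ x) / (1 - q)) * qGamma q x) *
          (Real.exp ((1 - q ^ y) / (1 - q)) * qGamma q y)) := by
  intro x y hx hy
  obtain ⟨C, hC⟩ := exp_mul_qGamma_eq_exp_tsum hq0 hq1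
  have hm : 1 ≤ √(x * y) := Real.one_le_sqrt.2 (by nlinarith)
  obtain ⟨Sx, hSx, ex⟩ := hC x hx
  obtain ⟨Sy, hSy, ey⟩ := hC y hy
  obtain ⟨Sm, hSm, em⟩ := hC _ hm
  rw [ex, ey, em, ← Real.exp_add]
  refine Real.le_sqrt_of_sq_le ?_
  rw [← Real.exp_nat_mul, Real.exp_le_exp]
  have hS : Sm ≤ (Sx + Sy) / 2 := hasSum_le (fun k => by
    have h := mul_sqrt_add_rpow_sqrt_div_le (pow_pos hq0 (k + 2))
      (pow_lt_one₀ hq0.le hq1 (by omega)) hx hy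
    rw [← add_div, div_right_comm]
    gcongr) hSm ((hSx.add hSy).div_const 2)
  have hAG : √(x * y) ≤ (x + y) / 2 :=
    Real.sqrt_le_iff.2 ⟨by linarith, by nlinarith [sq_nonneg (x - y)]⟩
  push_cast
  nlinarith
end

section
/- Let 0 < q < 1 and let α ≥ 1 satisfy ψ_q(α) ≥ 0. Then the function x ↦ x·(1 + ψ_q(x+α) − 1/(x+α)) is nondecreasing (indeed strictly increasing) on (0, ∞). -/
theorem summable_qDigamma {q x : ℝ} (hq0 : 0 < q) (hq1 : q < 1) (hx : 0 < x) :
    Summable fun n : ℕ => q ^ (((n : ℝ) + 1) * x) / (1 - q ^ (n + 1)) := by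
  have hgeom : Summable fun n : ℕ => (q ^ x) ^ (n + 1) / (1 - q) :=
    ((summable_nat_add_iff 1).2 (summable_geometric_of_lt_one (Real.rpow_nonneg hq0.le x)
      (Real.rpow_lt_one hq0.le hq1 hx))).div_const _
  refine Summable.of_nonneg_of_le (fun n => ?_) (fun n => ?_) hgeom
  · have := pow_le_one₀ (n := n + 1) hq0.le hq1.le
    exact div_nonneg (Real.rpow_nonneg hq0.le _) (by linarith)
  · have hpow : q ^ (((n : ℝ) + 1) * x) = (q ^ x) ^ (n + 1) := by
      rw [mul_comm, Real.rpow_mul hq0.le, ← Real.rpow_natCast]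
      push_cast
      rfl
    rw [hpow]
    have hle : q ^ (n + 1) ≤ q := pow_le_of_le_one hq0.le hq1.le n.succ_ne_zero
    exact div_le_div_of_nonneg_left (by positivity) (by linarith) (by linarith)

theorem monotoneOn_qDigamma {q : ℝ} (hq0 : 0 < q) (hq1 : q < 1) :
    MonotoneOn (qDigamma q) (Set.Ioi 0) := by
  intro x hx y hy hxy
  refine add_le_add_right (mul_le_mul_of_nonpos_left ?_ (Real.log_neg hq0 hq1).le) _
  refine (summable_qDigamma hq0 hq1 hy).tsum_le_tsum (fun n => ?_) (summable_qDigamma hq0 hq1 hx)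
  have hle := pow_le_one₀ (n := n + 1) hq0.le hq1.le
  refine div_le_div_of_nonneg_right ?_ (by linarith)
  exact Real.rpow_le_rpow_of_exponent_ge hq0 hq1.le
    (mul_le_mul_of_nonneg_left hxy (by positivity))

theorem strictMonoOn_aux (q α : ℝ) (hq0 : 0 < q) (hq1 : q < 1)
    (hα : 1 ≤ α) (hψ : 0 ≤ qDigamma q α) :
    StrictMonoOn (fun x => x * (1 + qDigamma q (x + α) - 1 / (x + α))) (Set.Ioi (0 : ℝ)) := by
  intro x hx y hy hxy
  rw [Set.mem_Ioi] at hx hy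
  have hmono := monotoneOn_qDigamma hq0 hq1
  have hxα : qDigamma q α ≤ qDigamma q (x + α) :=
    hmono (Set.mem_Ioi.2 (by linarith)) (Set.mem_Ioi.2 (by linarith)) (by linarith)
  have hyx : qDigamma q (x + α) ≤ qDigamma q (y + α) :=
    hmono (Set.mem_Ioi.2 (by linarith)) (Set.mem_Ioi.2 (by linarith)) (by linarith)
  have hinv : 1 / (x + α) < 1 := (div_lt_one (by linarith)).2 (by linarith)
  have hinv' : 1 / (y + α) < 1 / (x + α) := one_div_lt_one_div_of_lt (by linarith) (by linarith)
  exact mul_lt_mul'' hxy (by linarith) hx.le (by linarith)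
end
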